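/- arXiv:2307.09607 — 4 statements merged into one kernel-verified Lean document; each statement's English description precedes it below -/
import Mathlib

section
/- The SMC reweight step preserves proper weighting: let (Ω, P) be a probability space, X a measurable space with σ-finite reference measure ν, x : Ω → X measurable, and w : Ω → [0,∞) a nonnegative random variable. Let γ₀, γ₁ : X → [0,∞) be measurable with γ₀(u) > 0 for ν-almost every u with γ₁(u) > 0. If (w, x) is properly weighted for γ₀, then the pair (w·γ₁(x)/γ₀(x), x) is properly weighted for γ₁: for every bounded nonnegative measurable ψ : X → ℝ, E[w·(γ₁(x)/γ₀(x))·ψ(x)] = ∫ ψ·γ₁ dν. -/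
open MeasureTheory

/-- A pair `(w, x)` of a nonnegative weight `w : Ω → ℝ` and a random element `x : Ω → X`
is *properly weighted* for the unnormalized density `γ` with respect to the reference
measure `ν` if `E[w · ψ(x)] = ∫ ψ · γ dν` for every bounded nonnegative measurable `ψ`. -/
def ProperlyWeighted {Ω X : Type*} [MeasurableSpace Ω] [MeasurableSpace X]
    (P : Measure Ω) (ν : Measure X) (γ : X → ℝ) (w : Ω → ℝ) (x : Ω → X) : Prop :=
  ∀ ψ : X → ℝ, Measurable ψ → (∀ u, 0 ≤ ψ u) → (∃ C, ∀ u, ψ u ≤ C) →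
    ∫ ω, w ω * ψ (x ω) ∂P = ∫ u, ψ u * γ u ∂ν

/-- If `μ` and a nonzero σ-finite `ρ` have the same real-valued masses, then they agree. -/
lemma MeasureTheory.Measure.eq_of_real_eq_of_sigmaFinite {X : Type*} [MeasurableSpace X]
    {μ ρ : Measure X} [SigmaFinite ρ] (hρ : ρ ≠ 0)
    (h : ∀ A, MeasurableSet A → μ.real A = ρ.real A) : μ = ρ := by
  obtain ⟨n₀, hn₀⟩ : ∃ n, ρ (spanningSets ρ n) ≠ 0 := by
    by_contra! hc
    apply hρ
    rw [← Measure.measure_univ_eq_zero, ← iUnion_spanningSets ρ]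
    exact measure_iUnion_null hc
  have hfin : ∀ B, MeasurableSet B → ρ B ≠ ⊤ → μ B = ρ B := by
    intro B hB hBfin
    have hS := h (B ∪ spanningSets ρ n₀) (hB.union (measurableSet_spanningSets ρ n₀))
    have hpos : 0 < ρ.real (B ∪ spanningSets ρ n₀) :=
      ENNReal.toReal_pos (fun h0 => hn₀ (measure_mono_null Set.subset_union_right h0))
        (measure_union_ne_top hBfin (measure_spanningSets_lt_top ρ n₀).ne)
    have hμS : μ (B ∪ spanningSets ρ n₀) ≠ ⊤ := by
      rw [← hS] at hpos
      exact (ENNReal.toReal_pos_iff.mp hpos).2.ne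
    exact (ENNReal.toReal_eq_toReal_iff'
      (measure_ne_top_of_subset Set.subset_union_left hμS) hBfin).mp (h B hB)
  ext A hA
  have hAU : A = ⋃ n, A ∩ spanningSets ρ n := by
    rw [← Set.inter_iUnion, iUnion_spanningSets, Set.inter_univ]
  have hmono : Monotone fun n => A ∩ spanningSets ρ n :=
    fun _ _ hij => Set.inter_subset_inter_right A (monotone_spanningSets ρ hij)
  rw [hAU, hmono.measure_iUnion, hmono.measure_iUnion]
  refine iSup_congr fun n => hfin _ (hA.inter (measurableSet_spanningSets ρ n)) ?_
  exact measure_ne_top_of_subset Set.inter_subset_right (measure_spanningSets_lt_top ρ n).ne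

/-- Real-valued functions integrate to zero against a measure taking only the values `0`
and `∞`. -/
lemma MeasureTheory.integral_eq_zero_of_real_eq_zero {X : Type*} [MeasurableSpace X]
    {μ : Measure X} (h : ∀ A, MeasurableSet A → μ.real A = 0) {f : X → ℝ}
    (hf : Measurable f) : ∫ u, f u ∂μ = 0 := by
  by_cases hint : Integrable f μ
  · refine integral_eq_zero_of_ae ?_
    have hnull : ∀ n : ℕ, ∀ᵐ u ∂μ, ‖f u‖ < 1 / ((n : ℝ) + 1) := by
      intro n
      have hlt := hint.measure_norm_ge_lt_top (Nat.one_div_pos_of_nat (α := ℝ) (n := n))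
      have h0 := h _ (measurableSet_le measurable_const hf.norm :
        MeasurableSet {u | 1 / ((n : ℝ) + 1) ≤ ‖f u‖})
      rw [measureReal_eq_zero_iff hlt.ne] at h0
      simpa [ae_iff] using h0
    filter_upwards [ae_all_iff.mpr hnull] with u hu
    by_contra hne
    obtain ⟨n, hn⟩ := exists_nat_one_div_lt (norm_pos_iff.mpr hne)
    exact (hu n).not_gt hn
  · exact integral_undef hint

/-- If `ρ` is σ-finite and `μ` has the same real-valued masses, then `μ` and `ρ` give the same
Bochner integrals of measurable real functions. -/
lemma MeasureTheory.integral_eq_of_real_eq_of_sigmaFinite {X : Type*} [MeasurableSpace X]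
    {μ ρ : Measure X} [SigmaFinite ρ]
    (h : ∀ A, MeasurableSet A → μ.real A = ρ.real A) {f : X → ℝ} (hf : Measurable f) :
    ∫ u, f u ∂μ = ∫ u, f u ∂ρ := by
  rcases eq_or_ne ρ 0 with rfl | hρ
  · rw [integral_zero_measure]
    exact integral_eq_zero_of_real_eq_zero (fun A hA => by simpa using h A hA) hf
  · rw [Measure.eq_of_real_eq_of_sigmaFinite hρ h]

/-- Integration against the density `g ≥ 0`, written with real-valued `g`. -/
lemma MeasureTheory.integral_withDensity_toNNReal {X : Type*} [MeasurableSpace X]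
    (ν : Measure X) {g : X → ℝ} (hg : Measurable g) (hg0 : ∀ u, 0 ≤ g u) (f : X → ℝ) :
    ∫ u, f u ∂ν.withDensity (fun u => ((g u).toNNReal : ENNReal)) = ∫ u, g u * f u ∂ν := by
  rw [integral_withDensity_eq_integral_smul hg.real_toNNReal]
  simp [NNReal.smul_def, hg0]

/-- The SMC reweight step preserves proper weighting: multiplying the weight by the
incremental ratio `γ₁(x)/γ₀(x)` turns a pair properly weighted for `γ₀` into one
properly weighted for `γ₁`. -/
theorem reweight_preserves_properly_weighted
    {Ω X : Type*} [MeasurableSpace Ω] [MeasurableSpace X]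
    (P : Measure Ω) [IsProbabilityMeasure P] (ν : Measure X) [SigmaFinite ν]
    (x : Ω → X) (hx : Measurable x)
    (w : Ω → ℝ) (hw : Measurable w) (hw0 : ∀ ω, 0 ≤ w ω)
    (γ₀ γ₁ : X → ℝ) (hγ₀m : Measurable γ₀) (hγ₁m : Measurable γ₁)
    (hγ₀0 : ∀ u, 0 ≤ γ₀ u) (hγ₁0 : ∀ u, 0 ≤ γ₁ u)
    (hsupp : ∀ᵐ u ∂ν, 0 < γ₁ u → 0 < γ₀ u)
    (hpw : ProperlyWeighted P ν γ₀ w x) :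
    ProperlyWeighted P ν γ₁ (fun ω => w ω * (γ₁ (x ω) / γ₀ (x ω))) x := by
  set μ := (P.withDensity fun ω => ((w ω).toNNReal : ENNReal)).map x
  set ρ := ν.withDensity fun u => ((γ₀ u).toNNReal : ENNReal)
  have hμ : ∀ f : X → ℝ, Measurable f → ∫ u, f u ∂μ = ∫ ω, w ω * f (x ω) ∂P := by
    intro f hf
    rw [integral_map hx.aemeasurable hf.aestronglyMeasurable,
      integral_withDensity_toNNReal P hw hw0]
  have hρ := integral_withDensity_toNNReal ν hγ₀m hγ₀0
  have : SigmaFinite ρ := SigmaFinite.withDensity fun u => (γ₀ u).toNNReal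
  have hreal : ∀ A, MeasurableSet A → μ.real A = ρ.real A := by
    intro A hA
    have hA1 : Measurable (A.indicator (1 : X → ℝ)) := measurable_one.indicator hA
    rw [← integral_indicator_one hA, ← integral_indicator_one hA, hμ _ hA1, hρ,
      hpw _ hA1 (Set.indicator_nonneg fun _ _ => zero_le_one)
        ⟨1, Set.indicator_le_self' fun _ _ => zero_le_one⟩]
    simp_rw [mul_comm]
  intro ψ hψ _ _
  have hf : Measurable fun u => γ₁ u / γ₀ u * ψ u := (hγ₁m.div hγ₀m).mul hψ
  simp_rw [mul_assoc]
  rw [← hμ _ hf, integral_eq_of_real_eq_of_sigmaFinite hreal hf, hρ]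
  refine integral_congr_ae ?_
  filter_upwards [hsupp] with u hu
  rcases (hγ₁0 u).eq_or_lt with h1 | h1
  · simp [← h1]
  · have := (hu h1).ne'
    field_simp
end

section
/- Multinomial resampling preserves proper weighting: let (Ω, P) be a probability space, X a measurable space with σ-finite reference measure ν, and (w¹, x¹), …, (w^M, x^M) random pairs, each properly weighted for an unnormalized density γ on X, with Σ_{j=1}^M w^j > 0 almost surely. Let ι be a random index in {1, …, M} whose conditional distribution given all the pairs satisfies P(ι = i | (w¹,x¹),…,(w^M,x^M)) = w^i / Σ_{j=1}^M w^j, and set w̄ = (Σ_{j=1}^M w^j)/M. Then the pair (w̄, x^ι) is properly weighted for γ: for every bounded nonnegative measurable ψ, E[w̄·ψ(x^ι)] = ∫ ψ·γ dν. -/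
open MeasureTheory

/-- If an event `A` has conditional probability `p` given `Y`, tested against bounded measurable
functions of `Y`, then the same identity holds for every nonnegative extended-real function of `Y`. -/
theorem setLIntegral_comp_eq_of_forall_integral_eq
    {Ω E : Type*} [MeasurableSpace Ω] [MeasurableSpace E]
    {P : Measure Ω} [IsFiniteMeasure P] {Y : Ω → E} (hY : Measurable Y)
    {A : Set Ω} (hA : MeasurableSet A) {p : Ω → ℝ} (hp : Measurable p)
    (hp0 : ∀ ω, 0 ≤ p ω) (hp1 : ∀ ω, p ω ≤ 1)
    (h : ∀ g : E → ℝ, Measurable g → (∃ C, ∀ v, |g v| ≤ C) →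
      ∫ ω, A.indicator 1 ω * g (Y ω) ∂P = ∫ ω, p ω * g (Y ω) ∂P)
    {f : E → ENNReal} (hf : Measurable f) :
    ∫⁻ ω in A, f (Y ω) ∂P = ∫⁻ ω, ENNReal.ofReal (p ω) * f (Y ω) ∂P := by
  have hint : Integrable p P :=
    .of_bound hp.aestronglyMeasurable 1 (.of_forall fun ω => by
      rw [Real.norm_of_nonneg (hp0 ω)]; exact hp1 ω)
  have hmap : (P.restrict A).map Y = (P.withDensity fun ω => ENNReal.ofReal (p ω)).map Y := by
    ext s hs
    have hYs := hY hs
    rw [Measure.map_apply hY hs, Measure.map_apply hY hs, Measure.restrict_apply hYs,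
      withDensity_apply _ hYs, ← ofReal_integral_eq_lintegral_ofReal hint.integrableOn
        (.of_forall hp0), ← ofReal_measureReal (μ := P) (s := Y ⁻¹' s ∩ A)]
    congr 1
    have hs' := h (s.indicator 1) (measurable_one.indicator hs) ⟨1, fun v => by
      by_cases hv : v ∈ s <;> simp [hv]⟩
    have hl : ∀ ω, A.indicator 1 ω * s.indicator 1 (Y ω) =
        (Y ⁻¹' s ∩ A).indicator (1 : Ω → ℝ) ω := fun ω => by
      by_cases h1 : ω ∈ A <;> by_cases h2 : Y ω ∈ s <;> simp [h1, h2]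
    have hr : ∀ ω, p ω * s.indicator 1 (Y ω) = (Y ⁻¹' s).indicator p ω := fun ω => by
      by_cases h2 : Y ω ∈ s <;> simp [h2]
    simp_rw [hl, hr] at hs'
    rwa [integral_indicator_one (hYs.inter hA), integral_indicator hYs] at hs'
  rw [← lintegral_map hf hY, hmap, lintegral_map hf hY,
    lintegral_withDensity_eq_lintegral_mul _ hp.ennreal_ofReal (g := fun ω => f (Y ω))
      (hf.comp hY)]
  rfl

/-- A function defined by cases on a finite-valued index integrates to the sum over its fibres. -/
theorem lintegral_eq_sum_setLIntegral_fiber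
    {Ω κ : Type*} [MeasurableSpace Ω] [Fintype κ] [MeasurableSpace κ] [MeasurableSingletonClass κ]
    (P : Measure Ω) {ι : Ω → κ} (hι : Measurable ι) (F : κ → Ω → ENNReal) :
    ∫⁻ ω, F (ι ω) ω ∂P = ∑ i, ∫⁻ ω in ι ⁻¹' {i}, F i ω ∂P := by
  have hm : ∀ i, MeasurableSet (ι ⁻¹' {i}) := fun i => hι (measurableSet_singleton i)
  have hU : (⋃ i, ι ⁻¹' {i}) = Set.univ := by ext; simp
  rw [← setLIntegral_univ, ← hU, lintegral_iUnion hm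
    (fun i j hij => (Set.disjoint_singleton.2 hij).preimage ι), tsum_fintype]
  refine Finset.sum_congr rfl fun i _ => setLIntegral_congr_fun (hm i) fun ω hω => ?_
  simp only [Set.mem_preimage, Set.mem_singleton_iff] at hω
  simp only [hω]

/-- If finitely many extended nonnegative numbers have the same real part, so does their mean,
even when some of them are infinite. -/
theorem ENNReal.toReal_sum_div_card {κ : Type*} [Fintype κ] [Nonempty κ] {a : κ → ENNReal} {c : ℝ}
    (h : ∀ i, (a i).toReal = c) : ((∑ i, a i) / Fintype.card κ).toReal = c := by
  by_cases ht : ∀ i, a i ≠ ⊤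
  · rw [ENNReal.toReal_div, ENNReal.toReal_sum fun i _ => ht i]
    simp [h]
  · push Not at ht
    obtain ⟨i, hi⟩ := ht
    have hs : ∑ i, a i = ⊤ := ENNReal.sum_eq_top.2 ⟨i, Finset.mem_univ i, hi⟩
    rw [hs, ENNReal.top_div_of_ne_top (by simp), ← h i, hi]

/-- Multinomial resampling preserves proper weighting: if each pair `(w i, x i)` is
properly weighted for `γ`, the total weight is a.s. positive, and `ι` is a random index
chosen with conditional probability proportional to the weights given all the pairs,
then the resampled pair `((∑ j, w j)/M, x ι)` is properly weighted for `γ`. -/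
theorem resampling_preserves_properly_weighted
    {Ω X : Type*} [MeasurableSpace Ω] [MeasurableSpace X]
    (P : Measure Ω) [IsProbabilityMeasure P] (ν : Measure X) [SigmaFinite ν]
    (γ : X → ℝ) (M : ℕ) (hM : 0 < M)
    (w : Fin M → Ω → ℝ) (hwm : ∀ i, Measurable (w i)) (hw0 : ∀ i ω, 0 ≤ w i ω)
    (x : Fin M → Ω → X) (hxm : ∀ i, Measurable (x i))
    (hpw : ∀ i, ProperlyWeighted P ν γ (w i) (x i))
    (hpos : ∀ᵐ ω ∂P, 0 < ∑ j, w j ω)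
    (ι : Ω → Fin M) (hι : Measurable ι)
    (hcond : ∀ (i : Fin M) (g : (Fin M → ℝ) × (Fin M → X) → ℝ),
      Measurable g → (∃ C, ∀ v, |g v| ≤ C) →
      ∫ ω, (if ι ω = i then (1 : ℝ) else 0) *
          g (fun j => w j ω, fun j => x j ω) ∂P =
      ∫ ω, (w i ω / ∑ j, w j ω) *
          g (fun j => w j ω, fun j => x j ω) ∂P) :
    ProperlyWeighted P ν γ (fun ω => (∑ j, w j ω) / M) (fun ω => x (ι ω) ω) := by
  intro ψ hψ hψ0 hψC
  have : NeZero M := ⟨hM.ne'⟩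
  have hS0 : ∀ ω, 0 ≤ ∑ j, w j ω := fun ω => Finset.sum_nonneg fun j _ => hw0 j ω
  have hSm : Measurable fun ω => ∑ j, w j ω := Finset.measurable_sum _ fun j _ => hwm j
  have hxι : Measurable fun ω => x (ι ω) ω :=
    (measurable_from_prod_countable_right (f := fun q : Fin M × Ω => x q.1 q.2) hxm).comp
      (hι.prodMk measurable_id)
  have hY : Measurable fun ω => ((fun j => w j ω, fun j => x j ω) : (Fin M → ℝ) × (Fin M → X)) :=
    (measurable_pi_lambda _ hwm).prodMk (measurable_pi_lambda _ hxm)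
  have hfiber : ∀ i, ∫⁻ ω in ι ⁻¹' {i}, ENNReal.ofReal ((∑ j, w j ω) / M * ψ (x i ω)) ∂P =
      (∫⁻ ω, ENNReal.ofReal (w i ω * ψ (x i ω)) ∂P) / M := by
    intro i
    have hf : Measurable fun v : (Fin M → ℝ) × (Fin M → X) =>
        ENNReal.ofReal ((∑ j, v.1 j) / M * ψ (v.2 i)) := by fun_prop
    have hind : ∀ ω, (ι ⁻¹' {i}).indicator (1 : Ω → ℝ) ω = if ι ω = i then 1 else 0 := fun ω => by
      by_cases h : ι ω = i <;> simp [h]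
    have hcond' := setLIntegral_comp_eq_of_forall_integral_eq (P := P) hY
      (p := fun ω => w i ω / ∑ j, w j ω)
      (hι (measurableSet_singleton i)) ((hwm i).div hSm)
      (fun ω => div_nonneg (hw0 i ω) (hS0 ω))
      (fun ω => div_le_one_of_le₀
        (Finset.single_le_sum (fun j _ => hw0 j ω) (Finset.mem_univ i)) (hS0 ω))
      (fun g hg hgC => by
        simp_rw [hind]
        exact hcond i g hg hgC) hf
    refine hcond'.trans ?_
    rw [ENNReal.div_eq_inv_mul, ← lintegral_const_mul _
      (f := fun ω => ENNReal.ofReal (w i ω * ψ (x i ω))) ((hwm i).mul (hψ.comp (hxm i))).ennreal_ofReal]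
    refine lintegral_congr_ae ?_
    filter_upwards [hpos] with ω hω
    have hM' : (0 : ℝ) < M := Nat.cast_pos.2 hM
    rw [← ENNReal.ofReal_natCast M, ← ENNReal.ofReal_inv_of_pos hM',
      ← ENNReal.ofReal_mul (inv_nonneg.2 hM'.le),
      ← ENNReal.ofReal_mul (div_nonneg (hw0 i ω) (hS0 ω))]
    congr 1
    field_simp
  have hmean : ∀ i, (∫⁻ ω, ENNReal.ofReal (w i ω * ψ (x i ω)) ∂P).toReal =
      ∫ u, ψ u * γ u ∂ν := fun i => by
    rw [← hpw i ψ hψ hψ0 hψC, integral_eq_lintegral_of_nonneg_ae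
      (.of_forall fun ω => mul_nonneg (hw0 i ω) (hψ0 _))
      ((hwm i).mul (hψ.comp (hxm i))).aestronglyMeasurable]
  rw [integral_eq_lintegral_of_nonneg_ae
    (.of_forall fun ω => mul_nonneg (div_nonneg (hS0 ω) M.cast_nonneg) (hψ0 _))
    ((hSm.div_const _).mul (hψ.comp hxι)).aestronglyMeasurable,
    lintegral_eq_sum_setLIntegral_fiber P hι
      fun i ω => ENNReal.ofReal ((∑ j, w j ω) / M * ψ (x i ω))]
  simp_rw [hfiber, div_eq_mul_inv]
  rw [← Finset.sum_mul, ← div_eq_mul_inv]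
  simpa using ENNReal.toReal_sum_div_card hmean
end

section
/- Stationary-kernel rejuvenation preserves proper weighting: let (Ω, P) be a probability space, X a measurable space with σ-finite reference measure ν, γ : X → [0,∞) measurable with 0 < Z = ∫ γ dν < ∞, and π the probability measure with density γ/Z with respect to ν. Let κ be a Markov kernel on X leaving π invariant (i.e., ∫ κ(u, A) dπ(u) = π(A) for all measurable A). Suppose (w, x) is properly weighted for γ, and x' is a random element of X whose conditional distribution given (w, x) is κ(x, ·) (so that E[ψ(x') | w, x] = ∫ ψ(u) κ(x, du) for bounded measurable ψ). Then (w, x') is properly weighted for γ: for every bounded nonnegative measurable ψ, E[w·ψ(x')] = ∫ ψ·γ dν. -/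
open MeasureTheory

open ProbabilityTheory

open Filter Topology

/-- An identity `E[g(w, x) · a] = E[g(w, x) · b]` valid for all bounded test functions `g` and
bounded `a`, `b` extends to the integrable weight `w` itself. -/
lemma integral_mul_eq_of_forall_bounded {Ω X : Type*} [MeasurableSpace Ω] [MeasurableSpace X]
    {P : Measure Ω} {w : Ω → ℝ} (hw0 : ∀ ω, 0 ≤ w ω) (hwm : Measurable w) (hw : Integrable w P)
    (x : Ω → X) {a b : Ω → ℝ} (ha : Measurable a) (hb : Measurable b) {C : ℝ}
    (haC : ∀ ω, |a ω| ≤ C) (hbC : ∀ ω, |b ω| ≤ C)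
    (h : ∀ g : ℝ × X → ℝ, Measurable g → (∃ K, ∀ v, |g v| ≤ K) →
      ∫ ω, g (w ω, x ω) * a ω ∂P = ∫ ω, g (w ω, x ω) * b ω ∂P) :
    ∫ ω, w ω * a ω ∂P = ∫ ω, w ω * b ω ∂P := by
  have truncate : ∀ c : Ω → ℝ, Measurable c → (∀ ω, |c ω| ≤ C) →
      Tendsto (fun n : ℕ => ∫ ω, min |w ω| n * c ω ∂P) atTop (𝓝 (∫ ω, w ω * c ω ∂P)) := by
    intro c hc hcC
    refine tendsto_integral_of_dominated_convergence (fun ω => w ω * C)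
      (fun n => by fun_prop) (hw.mul_const C) (fun n => .of_forall fun ω => ?_)
      (.of_forall fun ω => ?_)
    · have hmin : 0 ≤ min |w ω| (n : ℝ) := by positivity
      rw [Real.norm_eq_abs, abs_mul, abs_of_nonneg hmin]
      exact mul_le_mul ((min_le_left _ _).trans_eq (abs_of_nonneg (hw0 ω))) (hcC ω)
        (abs_nonneg _) (hw0 ω)
    · refine tendsto_const_nhds.congr' ?_
      filter_upwards [eventually_ge_atTop ⌈w ω⌉₊] with n hn
      rw [abs_of_nonneg (hw0 ω), min_eq_left (Nat.ceil_le.mp hn)]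
  refine tendsto_nhds_unique (truncate a ha haC) ((truncate b hb hbC).congr fun n => ?_)
  refine (h (fun v => min |v.1| n) (by fun_prop) ⟨n, fun v => ?_⟩).symm
  rw [abs_of_nonneg (by positivity)]
  exact min_le_right _ _

/-- Integration against the normalized density `γ / Z`. -/
lemma integral_withDensity_div {X : Type*} [MeasurableSpace X] {ν : Measure X}
    {γ : X → ℝ} (hγm : Measurable γ) (hγ0 : ∀ u, 0 ≤ γ u) {Z : ℝ} (hZ : 0 < Z) (f : X → ℝ) :
    ∫ u, f u ∂(ν.withDensity fun u => ENNReal.ofReal (γ u / Z)) = (∫ u, f u * γ u ∂ν) / Z := by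
  rw [integral_withDensity_eq_integral_toReal_smul (by fun_prop)
    (.of_forall fun _ => ENNReal.ofReal_lt_top), ← integral_div]
  refine integral_congr_ae (.of_forall fun u => ?_)
  simp only [smul_eq_mul, ENNReal.toReal_ofReal (div_nonneg (hγ0 u) hZ.le)]
  ring

/-- Integrating against `π κ` is integrating first against `κ`, then against `π`. -/
lemma integral_bind_kernel {X Y : Type*} [MeasurableSpace X] [MeasurableSpace Y] {π : Measure X}
    [SFinite π] {κ : Kernel X Y} [IsSFiniteKernel κ] {f : Y → ℝ} (hf : Integrable f (π.bind κ)) :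
    ∫ y, f y ∂(π.bind κ) = ∫ x, ∫ y, f y ∂(κ x) ∂π := by
  rw [Measure.comp_eq_comp_const_apply] at hf ⊢
  rw [Kernel.integral_comp hf, Kernel.const_apply]

/-- Stationary-kernel rejuvenation preserves proper weighting: moving the particle `x`
through a Markov kernel `κ` that leaves the normalized target `π = γ/Z · ν` invariant,
while keeping the weight `w`, yields a pair still properly weighted for `γ`. -/
theorem rejuvenation_preserves_properly_weighted
    {Ω X : Type*} [MeasurableSpace Ω] [MeasurableSpace X]
    (P : Measure Ω) [IsProbabilityMeasure P] (ν : Measure X) [SigmaFinite ν]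
    (γ : X → ℝ) (hγm : Measurable γ) (hγ0 : ∀ u, 0 ≤ γ u)
    (Z : ℝ) (hZ : Z = ∫ u, γ u ∂ν) (hZpos : 0 < Z)
    (hγint : Integrable γ ν)
    (π : Measure X)
    (hπ : π = ν.withDensity (fun u => ENNReal.ofReal (γ u / Z)))
    (κ : Kernel X X) [IsMarkovKernel κ]
    (hinv : π.bind (fun u => κ u) = π)
    (w : Ω → ℝ) (hw0 : ∀ ω, 0 ≤ w ω) (hwm : Measurable w)
    (x : Ω → X) (hxm : Measurable x)
    (hpw : ProperlyWeighted P ν γ w x)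
    (x' : Ω → X) (hx'm : Measurable x')
    (hcond : ∀ (ψ : X → ℝ), Measurable ψ → (∃ C, ∀ u, |ψ u| ≤ C) →
      ∀ (g : ℝ × X → ℝ), Measurable g → (∃ C, ∀ v, |g v| ≤ C) →
      ∫ ω, g (w ω, x ω) * ψ (x' ω) ∂P =
      ∫ ω, g (w ω, x ω) * (∫ u, ψ u ∂(κ (x ω))) ∂P) :
    ProperlyWeighted P ν γ w x' := by
  intro ψ hψm hψ0 ⟨C, hψC⟩
  have hψabs : ∀ u, |ψ u| ≤ C := fun u => (abs_of_nonneg (hψ0 u)).trans_le (hψC u)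
  have hw : Integrable w P := by
    refine .of_integral_ne_zero ?_
    have h := hpw (fun _ => 1) measurable_const (fun _ => zero_le_one) ⟨1, fun _ => le_rfl⟩
    simp only [mul_one, one_mul, ← hZ] at h
    exact h ▸ hZpos.ne'
  have hφm : Measurable fun u => ∫ v, ψ v ∂(κ u) :=
    hψm.stronglyMeasurable.integral_kernel.measurable
  have hφ0 : ∀ u, 0 ≤ ∫ v, ψ v ∂(κ u) := fun u => integral_nonneg hψ0
  have hφC : ∀ u, ∫ v, ψ v ∂(κ u) ≤ C := fun u => by
    have h := norm_integral_le_of_norm_le_const (f := ψ) (C := C) (μ := κ u) (.of_forall hψabs)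
    rw [probReal_univ, mul_one] at h
    exact (le_abs_self _).trans h
  have hπfin : IsFiniteMeasure π := by
    rw [hπ]
    exact isFiniteMeasure_withDensity_ofReal (hγint.div_const Z).2
  have hbind : ∫ u, ∫ v, ψ v ∂(κ u) ∂π = ∫ u, ψ u ∂π := by
    have hψint : Integrable ψ (π.bind fun u => κ u) := by
      rw [hinv]
      exact .of_bound hψm.aestronglyMeasurable C (.of_forall hψabs)
    rw [← integral_bind_kernel hψint, hinv]
  rw [integral_mul_eq_of_forall_bounded hw0 hwm hw x (a := fun ω => ψ (x' ω))
      (b := fun ω => ∫ v, ψ v ∂(κ (x ω))) (hψm.comp hx'm) (hφm.comp hxm)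
      (fun ω => hψabs (x' ω))
      (fun ω => (abs_of_nonneg (hφ0 (x ω))).trans_le (hφC (x ω)))
      (hcond ψ hψm ⟨C, hψabs⟩)]
  refine (hpw _ hφm hφ0 ⟨C, hφC⟩).trans ?_
  rw [hπ, integral_withDensity_div hγm hγ0 hZpos, integral_withDensity_div hγm hγ0 hZpos] at hbind
  exact (div_left_inj' hZpos.ne').mp hbind
end

section
/- Correctness of the general SMC particle-evolution weight update: let X be a measurable space with σ-finite reference measure ν, let γ₀, γ₁ : X → [0,∞) be measurable unnormalized densities, and let k, l : X × X → [0,∞) be measurable functions such that u' ↦ k(u, u') is a probability density with respect to ν for each u, v ↦ l(u', v) is a probability density with respect to ν for each u', and γ₀(u)·k(u, u') > 0 whenever γ₁(u')·l(u', u) > 0. Suppose (w, x) is properly weighted for γ₀, and x' is a random element whose conditional distribution given (w, x) has density k(x, ·) with respect to ν. Define w' = w · [γ₁(x')·l(x', x)] / [γ₀(x)·k(x, x')]. Then (w', x') is properly weighted for γ₁: for every bounded nonnegative measurable ψ, E[w'·ψ(x')] = ∫ ψ·γ₁ dν. -/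
open MeasureTheory

open ProbabilityTheory

/-- Measures with the same real values on measurable sets are equal when one of them is
nonzero and `σ`-finite. The other one may a priori take the value `∞` where the first does not. -/
theorem MeasureTheory.Measure.eq_of_forall_measureReal_eq {X : Type*} [MeasurableSpace X]
    {μ ρ : Measure X} [SigmaFinite ρ] (hρ : ρ ≠ 0)
    (h : ∀ s, MeasurableSet s → μ.real s = ρ.real s) : μ = ρ := by
  obtain ⟨b, hb, -, hb0, hbtop⟩ := Measure.exists_subset_measure_lt_top (μ := ρ) (r := 0)
    MeasurableSet.univ (Measure.measure_univ_pos.2 hρ)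
  have hS : ∀ n, MeasurableSet (spanningSets ρ n ∪ b) := fun n =>
    (measurableSet_spanningSets ρ n).union hb
  have hρS : ∀ n, ρ (spanningSets ρ n ∪ b) < ⊤ := fun n =>
    measure_union_lt_top (measure_spanningSets_lt_top ρ n) hbtop
  have hμS : ∀ n, μ (spanningSets ρ n ∪ b) ≠ ⊤ := by
    intro n htop
    have hpos : 0 < ρ.real (spanningSets ρ n ∪ b) :=
      ENNReal.toReal_pos (hb0.trans_le (measure_mono Set.subset_union_right)).ne' (hρS n).ne
    rw [← h _ (hS n), measureReal_def, htop] at hpos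
    simp at hpos
  have hU : ⋃ n, (spanningSets ρ n ∪ b) = Set.univ := by
    rw [← Set.iUnion_union, iUnion_spanningSets, Set.univ_union]
  refine (Measure.ext_iff_of_iUnion_eq_univ hU).2 fun n => Measure.ext fun s hs => ?_
  rw [Measure.restrict_apply hs, Measure.restrict_apply hs]
  exact (ENNReal.toReal_eq_toReal_iff' (measure_ne_top_of_subset Set.inter_subset_right (hμS n))
    (measure_ne_top_of_subset Set.inter_subset_right (hρS n).ne)).1 (h _ (hs.inter (hS n)))

theorem ProperlyWeighted.map_withDensity {Ω X : Type*} [MeasurableSpace Ω] [MeasurableSpace X]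
    {P : Measure Ω} {ν : Measure X} [SigmaFinite ν] {γ : X → ℝ} {w : Ω → ℝ} {x : Ω → X}
    (h : ProperlyWeighted P ν γ w x) (hγm : Measurable γ) (hγ0 : ∀ u, 0 ≤ γ u)
    (hγ : ¬ γ =ᵐ[ν] 0) (hw0 : ∀ ω, 0 ≤ w ω) (hwm : Measurable w) (hxm : Measurable x) :
    (P.withDensity fun ω => ENNReal.ofReal (w ω)).map x =
      ν.withDensity fun u => ENNReal.ofReal (γ u) := by
  have : SigmaFinite (ν.withDensity fun u => ENNReal.ofReal (γ u)) :=
    SigmaFinite.withDensity_ofReal γ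
  refine Measure.eq_of_forall_measureReal_eq (fun h0 => hγ ?_) fun s hs => ?_
  · rw [withDensity_eq_zero_iff hγm.ennreal_ofReal.aemeasurable] at h0
    filter_upwards [h0] with u hu
    exact le_antisymm (ENNReal.ofReal_eq_zero.1 hu) (hγ0 u)
  · have key := h (s.indicator 1) (measurable_one.indicator hs)
      (fun u => Set.indicator_nonneg (fun _ _ => zero_le_one) u)
      ⟨1, fun u => Set.indicator_le_self' (fun _ _ => zero_le_one) u⟩
    have hl : ∀ ω, w ω * s.indicator 1 (x ω) = (x ⁻¹' s).indicator w ω := fun ω => by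
      by_cases hω : x ω ∈ s <;> simp [hω]
    have hr : ∀ u, s.indicator 1 u * γ u = s.indicator γ u := fun u => by
      by_cases hu : u ∈ s <;> simp [hu]
    simp_rw [hl, hr] at key
    rw [integral_indicator (hxm hs), integral_indicator hs,
      integral_eq_lintegral_of_nonneg_ae (ae_of_all _ hw0) hwm.aestronglyMeasurable,
      integral_eq_lintegral_of_nonneg_ae (ae_of_all _ hγ0) hγm.aestronglyMeasurable] at key
    rw [measureReal_def, measureReal_def, Measure.map_apply hxm hs, withDensity_apply _ (hxm hs),
      withDensity_apply _ hs, key]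

/-- If `y'` has conditional density `k (y ·) ·` given `y`, tested on bounded functions, then the
corresponding disintegration holds for every nonnegative measurable function of `(y, y')`. -/
theorem lintegral_eq_of_condDensity {Ω X Y : Type*} [MeasurableSpace Ω] [MeasurableSpace X]
    [MeasurableSpace Y] {P : Measure Ω} [IsFiniteMeasure P] {ν : Measure X} [SigmaFinite ν]
    {k : Y → X → ℝ} (hkm : Measurable (Function.uncurry k)) (hk0 : ∀ v u, 0 ≤ k v u)
    (hkdens : ∀ v, ∫ u, k v u ∂ν = 1) {y : Ω → Y} (hym : Measurable y)
    {y' : Ω → X} (hy'm : Measurable y')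
    (hcond : ∀ (ψ : X → ℝ), Measurable ψ → (∃ C, ∀ u, |ψ u| ≤ C) →
      ∀ (g : Y → ℝ), Measurable g → (∃ C, ∀ v, |g v| ≤ C) →
      ∫ ω, g (y ω) * ψ (y' ω) ∂P = ∫ ω, g (y ω) * (∫ u, ψ u * k (y ω) u ∂ν) ∂P)
    {f : Y × X → ENNReal} (hf : Measurable f) :
    ∫⁻ ω, f (y ω, y' ω) ∂P = ∫⁻ ω, ∫⁻ u, ENNReal.ofReal (k (y ω) u) * f (y ω, u) ∂ν ∂P := by
  have hkm' : Measurable (Function.uncurry fun v u => ENNReal.ofReal (k v u)) :=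
    hkm.ennreal_ofReal
  let κ : Kernel Y X := (Kernel.const Y ν).withDensity fun v u => ENNReal.ofReal (k v u)
  have hκ : ∀ v s, κ v s = ∫⁻ u in s, ENNReal.ofReal (k v u) ∂ν := fun v s => by
    rw [Kernel.withDensity_apply' _ hkm', Kernel.const_apply]
  have hκ_real : ∀ v s, MeasurableSet s → (κ v).real s = ∫ u, s.indicator 1 u * k v u ∂ν := by
    intro v s hs
    have hr : ∀ u, s.indicator 1 u * k v u = s.indicator (k v) u := fun u => by
      by_cases hu : u ∈ s <;> simp [hu]
    simp_rw [hr]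
    rw [integral_indicator hs, integral_eq_lintegral_of_nonneg_ae (ae_of_all _ (hk0 v))
      (hkm.of_uncurry_left).aestronglyMeasurable, measureReal_def, hκ]
  have hκ_markov : IsMarkovKernel κ := ⟨fun v => ⟨by
    rw [← ENNReal.toReal_eq_one_iff, ← measureReal_def, hκ_real v _ MeasurableSet.univ]
    simpa using hkdens v⟩⟩
  have hlaw : P.map (fun ω => (y ω, y' ω)) = (P.map y) ⊗ₘ κ := by
    refine Measure.ext_prod fun {s t} hs ht => ?_
    refine (ENNReal.toReal_eq_toReal_iff' (measure_ne_top _ _) (measure_ne_top _ _)).1 ?_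
    have key := hcond (t.indicator 1) (measurable_one.indicator ht)
      ⟨1, fun z => by by_cases hz : z ∈ t <;> simp [hz]⟩
      (s.indicator 1) (measurable_one.indicator hs)
      ⟨1, fun z => by by_cases hz : z ∈ s <;> simp [hz]⟩
    have hl : ∀ ω, s.indicator (1 : Y → ℝ) (y ω) * t.indicator 1 (y' ω) =
        ((fun ω => (y ω, y' ω)) ⁻¹' s ×ˢ t).indicator 1 ω := fun ω => by
      by_cases h₁ : y ω ∈ s <;> by_cases h₂ : y' ω ∈ t <;> simp [h₁, h₂]
    have hr : ∀ ω, s.indicator (1 : Y → ℝ) (y ω) * (∫ u, t.indicator 1 u * k (y ω) u ∂ν) =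
        (y ⁻¹' s).indicator (fun ω => (κ (y ω)).real t) ω := fun ω => by
      rw [← hκ_real _ _ ht]
      by_cases h₁ : y ω ∈ s <;> simp [h₁]
    simp_rw [hl, hr] at key
    rw [integral_indicator_one ((hym.prodMk hy'm) (hs.prod ht)),
      integral_indicator (hym hs)] at key
    simp_rw [measureReal_def] at key
    rw [integral_toReal ((κ.measurable_coe ht).fun_comp hym).aemeasurable
      (ae_of_all _ fun ω => measure_lt_top _ _)] at key
    rw [Measure.map_apply (hym.prodMk hy'm) (hs.prod ht), key, Measure.compProd_apply_prod hs ht,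
      setLIntegral_map hs (κ.measurable_coe ht) hym]
  calc ∫⁻ ω, f (y ω, y' ω) ∂P = ∫⁻ z, f z ∂((P.map y) ⊗ₘ κ) := by
        rw [← hlaw, lintegral_map hf (hym.prodMk hy'm)]
    _ = ∫⁻ v, ∫⁻ u, f (v, u) ∂κ v ∂(P.map y) := Measure.lintegral_compProd hf
    _ = ∫⁻ ω, ∫⁻ u, f (y ω, u) ∂κ (y ω) ∂P := lintegral_map (hf.lintegral_kernel_prod_right') hym
    _ = _ := by
        refine lintegral_congr fun ω => ?_
        exact (Kernel.lintegral_withDensity _ hkm' _ (hf.fun_comp measurable_prodMk_left)).trans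
          (by rw [Kernel.const_apply])

/-- Correctness of the general SMC particle-evolution weight update: evolving the
particle through a forward kernel with density `k` and updating the weight by
`[γ₁(x')·l(x',x)] / [γ₀(x)·k(x,x')]` for any backward kernel density `l`
produces a pair properly weighted for `γ₁`. -/
theorem smc_weight_update_properly_weighted
    {Ω X : Type*} [MeasurableSpace Ω] [MeasurableSpace X]
    (P : Measure Ω) [IsProbabilityMeasure P] (ν : Measure X) [SigmaFinite ν]
    (γ₀ γ₁ : X → ℝ) (hγ₀m : Measurable γ₀) (hγ₁m : Measurable γ₁)
    (hγ₀0 : ∀ u, 0 ≤ γ₀ u) (hγ₁0 : ∀ u, 0 ≤ γ₁ u)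
    (k l : X → X → ℝ)
    (hkm : Measurable (Function.uncurry k)) (hlm : Measurable (Function.uncurry l))
    (hk0 : ∀ u u', 0 ≤ k u u') (hl0 : ∀ u' v, 0 ≤ l u' v)
    (hkdens : ∀ u, ∫ u', k u u' ∂ν = 1)
    (hldens : ∀ u', ∫ v, l u' v ∂ν = 1)
    (hsupp : ∀ u u', 0 < γ₁ u' * l u' u → 0 < γ₀ u * k u u')
    (w : Ω → ℝ) (hw0 : ∀ ω, 0 ≤ w ω) (hwm : Measurable w)
    (x : Ω → X) (hxm : Measurable x)
    (hpw : ProperlyWeighted P ν γ₀ w x)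
    (x' : Ω → X) (hx'm : Measurable x')
    (hcond : ∀ (ψ : X → ℝ), Measurable ψ → (∃ C, ∀ u, |ψ u| ≤ C) →
      ∀ (g : ℝ × X → ℝ), Measurable g → (∃ C, ∀ v, |g v| ≤ C) →
      ∫ ω, g (w ω, x ω) * ψ (x' ω) ∂P =
      ∫ ω, g (w ω, x ω) * (∫ u, ψ u * k (x ω) u ∂ν) ∂P) :
    ProperlyWeighted P ν γ₁
      (fun ω => w ω * (γ₁ (x' ω) * l (x' ω) (x ω)) / (γ₀ (x ω) * k (x ω) (x' ω)))
      x' := by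
  intro ψ hψm hψ0 _
  have hlint : ∀ u', ∫⁻ v, ENNReal.ofReal (l u' v) ∂ν = 1 := fun u' => by
    rw [← ofReal_integral_eq_lintegral_ofReal
      (Integrable.of_integral_ne_zero (by simp [hldens u'])) (ae_of_all _ (hl0 u')),
      hldens, ENNReal.ofReal_one]
  by_cases hγ : γ₀ =ᵐ[ν] 0
  · have hγ₁ : ∀ u', γ₁ u' = 0 := by
      intro u'
      have hae : (fun v => γ₁ u' * l u' v) =ᵐ[ν] 0 := by
        filter_upwards [hγ] with v hv
        by_contra hne
        have hpos := hsupp v u' ((mul_nonneg (hγ₁0 u') (hl0 u' v)).lt_of_ne' hne)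
        simp [hv] at hpos
      have hint := integral_congr_ae hae
      simpa [integral_const_mul, hldens] using hint
    simp [hγ₁]
  have hmap := hpw.map_withDensity hγ₀m hγ₀0 hγ hw0 hwm hxm
  let r : X → X → ℝ := fun v u => γ₁ u * l u v / (γ₀ v * k v u) * ψ u
  have hr0 : ∀ v u, 0 ≤ r v u := fun v u => mul_nonneg (div_nonneg
    (mul_nonneg (hγ₁0 u) (hl0 u v)) (mul_nonneg (hγ₀0 v) (hk0 v u))) (hψ0 u)
  have hrm : Measurable (Function.uncurry r) :=
    (((hγ₁m.comp measurable_snd).mul (hlm.comp measurable_swap)).div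
      ((hγ₀m.comp measurable_fst).mul hkm)).mul (hψm.comp measurable_snd)
  have hFm : Measurable fun p : X × X => ENNReal.ofReal (k p.1 p.2) * ENNReal.ofReal (r p.1 p.2) :=
    hkm.ennreal_ofReal.mul hrm.ennreal_ofReal
  have hFm_right : ∀ v, Measurable fun u => ENNReal.ofReal (k v u) * ENNReal.ofReal (r v u) :=
    fun v => hFm.comp measurable_prodMk_left
  have hGm : Measurable fun v => ∫⁻ u, ENNReal.ofReal (k v u) * ENNReal.ofReal (r v u) ∂ν :=
    hFm.lintegral_prod_right'
  have hcancel : ∀ v u, γ₀ v * (k v u * r v u) = γ₁ u * ψ u * l u v := by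
    intro v u
    rcases (mul_nonneg (hγ₁0 u) (hl0 u v)).eq_or_lt' with h | h
    · simp only [r, h]
      linear_combination (-ψ u) * h
    · have hne := (hsupp v u h).ne'
      simp only [r]
      field_simp [left_ne_zero_of_mul hne, right_ne_zero_of_mul hne]
  have hwr : ∀ ω, w ω * (γ₁ (x' ω) * l (x' ω) (x ω)) / (γ₀ (x ω) * k (x ω) (x' ω)) * ψ (x' ω) =
      w ω * r (x ω) (x' ω) := fun ω => by simp only [r]; ring
  simp_rw [hwr]
  rw [integral_eq_lintegral_of_nonneg_ae (ae_of_all _ fun ω => mul_nonneg (hw0 ω) (hr0 _ _))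
      (hwm.mul (hrm.comp (hxm.prodMk hx'm))).aestronglyMeasurable,
    integral_eq_lintegral_of_nonneg_ae (ae_of_all _ fun u => mul_nonneg (hψ0 u) (hγ₁0 u))
      (hψm.mul hγ₁m).aestronglyMeasurable]
  congr 1
  calc ∫⁻ ω, ENNReal.ofReal (w ω * r (x ω) (x' ω)) ∂P
      = ∫⁻ ω, ∫⁻ u, ENNReal.ofReal (k (x ω) u) * ENNReal.ofReal (w ω * r (x ω) u) ∂ν ∂P :=
        lintegral_eq_of_condDensity (k := fun (v : ℝ × X) u => k v.2 u)
          (y := fun ω => (w ω, x ω)) (y' := x')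
          (f := fun p => ENNReal.ofReal (p.1.1 * r p.1.2 p.2))
          (hkm.comp ((measurable_snd.comp measurable_fst).prodMk measurable_snd))
          (fun v => hk0 v.2) (fun v => hkdens v.2) (hwm.prodMk hxm) hx'm hcond
          ((measurable_fst.comp measurable_fst).mul (hrm.comp
            ((measurable_snd.comp measurable_fst).prodMk measurable_snd))).ennreal_ofReal
    _ = ∫⁻ ω, ENNReal.ofReal (w ω) *
          ∫⁻ u, ENNReal.ofReal (k (x ω) u) * ENNReal.ofReal (r (x ω) u) ∂ν ∂P := by
        refine lintegral_congr fun ω => ?_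
        rw [← lintegral_const_mul _ (hFm_right _)]
        refine lintegral_congr fun u => ?_
        rw [ENNReal.ofReal_mul (hw0 ω), mul_left_comm]
    _ = ∫⁻ v, ∫⁻ u, ENNReal.ofReal (k v u) * ENNReal.ofReal (r v u) ∂ν
          ∂((P.withDensity fun ω => ENNReal.ofReal (w ω)).map x) := by
        rw [lintegral_map hGm hxm,
          lintegral_withDensity_eq_lintegral_mul _ hwm.ennreal_ofReal
            (hGm.fun_comp hxm)]
        rfl
    _ = ∫⁻ v, ENNReal.ofReal (γ₀ v) *
          ∫⁻ u, ENNReal.ofReal (k v u) * ENNReal.ofReal (r v u) ∂ν ∂ν := by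
        rw [hmap, lintegral_withDensity_eq_lintegral_mul _ hγ₀m.ennreal_ofReal hGm]
        rfl
    _ = ∫⁻ v, ∫⁻ u, ENNReal.ofReal (γ₁ u * ψ u) * ENNReal.ofReal (l u v) ∂ν ∂ν := by
        refine lintegral_congr fun v => ?_
        rw [← lintegral_const_mul _ (hFm_right _)]
        refine lintegral_congr fun u => ?_
        rw [← ENNReal.ofReal_mul (hk0 v u), ← ENNReal.ofReal_mul (hγ₀0 v), hcancel,
          ENNReal.ofReal_mul (mul_nonneg (hγ₁0 u) (hψ0 u))]
    _ = ∫⁻ u, ∫⁻ v, ENNReal.ofReal (γ₁ u * ψ u) * ENNReal.ofReal (l u v) ∂ν ∂ν :=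
        lintegral_lintegral_swap (((hγ₁m.mul hψm).comp measurable_snd).ennreal_ofReal.mul
          (hlm.comp measurable_swap).ennreal_ofReal).aemeasurable
    _ = ∫⁻ u, ENNReal.ofReal (ψ u * γ₁ u) ∂ν := by
        refine lintegral_congr fun u => ?_
        rw [lintegral_const_mul _ (hlm.of_uncurry_left).ennreal_ofReal, hlint, mul_one, mul_comm]
end
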